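/- Suppose T_F = T_E (so T = 2·T_E), longitudinal surrogacy holds at time T_E, the generalized surrogate index is affine in the surrogates (for all positive integers δ ≤ t ≤ T, x ∈ 𝕏, a ∈ {0,1}, the map s ↦ h^δ_t(s, x, a) agrees on 𝕊 with an affine map ℝ^D → ℝ, by which it is extended to ℝ^D), and extended-domain parallel trends holds: for all t, t′ ∈ {1,…,T}, every positive integer δ ≤ min(t, t′), all v_1, v_0 ∈ ℝ^D and x ∈ 𝕏 (using the affine extensions), h^δ_t(v_1, x, 1) − h^δ_{t′}(v_1, x, 1) = h^δ_t(v_0, x, 0) − h^δ_{t′}(v_0, x, 0). Then the average effect of the long-term treatment satisfies τ_T = E[ h_{T_E}( g_{T_E}(S_0, X, 1), X, 1) − h_{T_E}( g_{T_E}(S_0, X, 0), X, 0) ], where h_{T_E} denotes h^{T_E}_{T_E}, g_{T_E}(s, x, a) = E[S_{T_E} | S_0 = s, X = x, A = a], and the expectation is over (S_0, X). -/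

import Mathlib

open MeasureTheory ProbabilityTheory

section FiniteConditioning

variable {Ω β : Type*} [MeasurableSpace Ω] [Finite β] [MeasurableSpace β]
  [MeasurableSingletonClass β]

theorem integrable_comp_of_finite (μ : Measure Ω) [IsFiniteMeasure μ] {F : Ω → β}
    (hF : Measurable F) (φ : β → ℝ) : Integrable (fun ω => φ (F ω)) μ :=
  (Integrable.of_finite (μ := μ.map F) (f := φ)).comp_measurable hF

theorem integral_cond_eq (μ : Measure Ω) (s : Set Ω) (f : Ω → ℝ) :
    ∫ ω, f ω ∂(μ[|s]) = (μ s).toReal⁻¹ * ∫ ω in s, f ω ∂μ := by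
  rw [ProbabilityTheory.cond, integral_smul_measure, ENNReal.toReal_inv, smul_eq_mul]

/-- If `φ b` is the mean of `f` given `F = b` for every `b` of positive probability, then `f` and
`φ ∘ F` have the same integral over every event determined by `F`. -/
theorem setIntegral_preimage_eq_of_cond (μ : Measure Ω) [IsFiniteMeasure μ] {F : Ω → β}
    (hF : Measurable F) {f : Ω → ℝ} (hf : Integrable f μ) (φ : β → ℝ)
    (h : ∀ b, μ (F ⁻¹' {b}) ≠ 0 → ∫ ω, f ω ∂(μ[|F ⁻¹' {b}]) = φ b) (K : Set β) :
    ∫ ω in F ⁻¹' K, f ω ∂μ = ∫ ω in F ⁻¹' K, φ (F ω) ∂μ := by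
  have hfib (b : β) : ∫ ω in F ⁻¹' {b}, f ω ∂μ = ∫ ω in F ⁻¹' {b}, φ (F ω) ∂μ := by
    have hmeas : MeasurableSet (F ⁻¹' {b}) := hF (measurableSet_singleton b)
    have hconst : ∫ ω in F ⁻¹' {b}, φ (F ω) ∂μ = (μ (F ⁻¹' {b})).toReal * φ b := by
      rw [setIntegral_congr_fun (g := fun _ => φ b) hmeas
        (fun ω (hω : F ω = b) => by simp only [hω])]
      simp [Measure.real]
    rw [hconst]
    by_cases h0 : μ (F ⁻¹' {b}) = 0
    · simp [h0, setIntegral_measure_zero]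
    · have hne : (μ (F ⁻¹' {b})).toReal ≠ 0 :=
        ENNReal.toReal_ne_zero.2 ⟨h0, measure_ne_top _ _⟩
      rw [← h b h0, integral_cond_eq, mul_inv_cancel_left₀ hne]
  have hK : F ⁻¹' K = ⋃ b ∈ K.toFinite.toFinset, F ⁻¹' {b} := by
    ext ω
    simp
  have hdisj : Set.Pairwise (↑K.toFinite.toFinset : Set β)
      (Function.onFun Disjoint fun b => F ⁻¹' {b}) := fun b _ c _ hbc =>
    Disjoint.preimage F (Set.disjoint_singleton.2 hbc)
  rw [hK, integral_biUnion_finset _ (fun b _ => hF (measurableSet_singleton b)) hdisj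
      (fun b _ => hf.integrableOn),
    integral_biUnion_finset _ (fun b _ => hF (measurableSet_singleton b)) hdisj
      (fun b _ => (integrable_comp_of_finite μ hF φ).integrableOn)]
  exact Finset.sum_congr rfl fun b _ => hfib b

/-- Conditioning on an event of an independent variable does not change a mean. -/
theorem integral_cond_eq_of_indepFun (μ : Measure Ω) [IsProbabilityMeasure μ] {F : Ω → β}
    (hF : Measurable F) {γ : Type*} [MeasurableSpace γ] [MeasurableSingletonClass γ] {G : Ω → γ}
    (hG : Measurable G) (hFG : IndepFun F G μ) (c : γ) (hc : μ {ω | G ω = c} ≠ 0) (φ : β → ℝ) :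
    ∫ ω, φ (F ω) ∂(μ[|{ω | G ω = c}]) = ∫ ω, φ (F ω) ∂μ := by
  have hmeas : MeasurableSet {ω | G ω = c} := hG (measurableSet_singleton c)
  have hmap : (μ[|{ω | G ω = c}]).map F = μ.map F := by
    ext s hs
    rw [Measure.map_apply hF hs, Measure.map_apply hF hs, cond_apply hmeas, Set.inter_comm]
    have hinter : μ (F ⁻¹' s ∩ {ω | G ω = c}) = μ (F ⁻¹' s) * μ {ω | G ω = c} :=
      hFG.measure_inter_preimage_eq_mul _ _ hs (measurableSet_singleton c)
    rw [hinter, mul_comm, mul_assoc, ENNReal.mul_inv_cancel hc (measure_ne_top _ _), mul_one]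
  have hφ : Measurable φ := Measurable.of_discrete
  rw [← integral_map (μ := μ) hF.aemeasurable hφ.aestronglyMeasurable, ← hmap,
    integral_map hF.aemeasurable hφ.aestronglyMeasurable]

end FiniteConditioning

/-- An affine function commutes with the expectation. -/
theorem integral_affine {Ω : Type*} [MeasurableSpace Ω] (μ : Measure Ω) [IsProbabilityMeasure μ]
    {D : ℕ} {V : Ω → Fin D → ℝ} (hV : ∀ d, Integrable (fun ω => V ω d) μ) {ℓ : (Fin D → ℝ) → ℝ}
    (hℓ : ∃ (c₀ : ℝ) (c : Fin D → ℝ), ∀ v, ℓ v = c₀ + ∑ d, v d * c d) :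
    ∫ ω, ℓ (V ω) ∂μ = ℓ (fun d => ∫ ω, V ω d ∂μ) := by
  obtain ⟨c₀, c, h⟩ := hℓ
  simp only [h]
  rw [integral_add (integrable_const _)
      (integrable_finsetSum _ fun d _ => (hV d).mul_const (c d)),
    integral_finsetSum _ fun d _ => (hV d).mul_const (c d)]
  simp [integral_mul_const]

/-- Lemma (linear surrogate model under parallel trends, special case `T_F = T_E`):
under longitudinal surrogacy at time `T_E`, affineness of the generalized surrogate
index in the surrogates, and extended-domain parallel trends, the average effect of
the long-term treatment is identified by the surrogate index evaluated at the pivot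
index, in expectation over `(S_0, X)`. -/
theorem linear_surrogate_parallel_trends_special_case
    {Ω : Type*} [MeasurableSpace Ω] (P : Measure Ω) [IsProbabilityMeasure P]
    {𝕏 : Type*} [Fintype 𝕏] [MeasurableSpace 𝕏] [MeasurableSingletonClass 𝕏]
    (D T_E T_F : ℕ) (hD : 0 < D) (hTE : 0 < T_E) (hTF : 0 < T_F)
    (hTFE : T_F = T_E)
    (𝕊 : Finset (Fin D → ℝ))
    (X : Ω → 𝕏) (hX : Measurable X)
    (S : ℕ → Ω → (Fin D → ℝ)) (hSmeas : ∀ t, Measurable (S t))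
    (hSmem : ∀ t ω, S t ω ∈ 𝕊)
    (Y : ℕ → Ω → ℝ) (hYmeas : ∀ t, Measurable (Y t)) (hYint : ∀ t, Integrable (Y t) P)
    (A : Ω → Bool) (hA : Measurable A)
    -- randomized assignment: `A` is independent of `(X, S_0)`
    (hindep : IndepFun (fun ω => (X ω, S 0 ω)) A P)
    -- all conditioning events have positive probability
    (hApos : ∀ a : Bool, P {ω | A ω = a} ≠ 0)
    (hpos : ∀ r, r ≤ T_E + T_F → ∀ s ∈ 𝕊, ∀ (x : 𝕏) (a : Bool),
      P {ω | S r ω = s ∧ X ω = x ∧ A ω = a} ≠ 0)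
    -- longitudinal surrogacy at time `T_E`
    (hsurr : ∀ t, T_E < t → t ≤ T_E + T_F →
      ∀ s ∈ 𝕊, ∀ (x : 𝕏) (a : Bool) (hist : ℕ → (Fin D → ℝ)),
        P {ω | (∀ i < T_E, S i ω = hist i) ∧ S T_E ω = s ∧ X ω = x ∧ A ω = a} ≠ 0 →
        Measure.map (fun ω => (Y t ω, S t ω))
            (P[|{ω | (∀ i < T_E, S i ω = hist i) ∧ S T_E ω = s ∧ X ω = x ∧ A ω = a}])
          = Measure.map (fun ω => (Y t ω, S t ω))
            (P[|{ω | S T_E ω = s ∧ X ω = x ∧ A ω = a}]))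
    -- the generalized surrogate index `h^δ_t`, affine in the surrogates and agreeing
    -- on `𝕊` with the conditional expectation of `Y_t` given `(S_{t-δ}, X, A)`
    (hL : ℕ → ℕ → (Fin D → ℝ) → 𝕏 → Bool → ℝ)
    (hLaffine : ∀ t δ (x : 𝕏) (a : Bool), 1 ≤ δ → δ ≤ t → t ≤ T_E + T_F →
      ∃ (c₀ : ℝ) (c : Fin D → ℝ), ∀ v : Fin D → ℝ,
        hL t δ v x a = c₀ + ∑ d, v d * c d)
    (hLagree : ∀ t δ, 1 ≤ δ → δ ≤ t → t ≤ T_E + T_F → ∀ s ∈ 𝕊, ∀ (x : 𝕏) (a : Bool),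
      hL t δ s x a = ∫ ω, Y t ω ∂(P[|{ω | S (t - δ) ω = s ∧ X ω = x ∧ A ω = a}]))
    -- extended-domain parallel trends (using the affine extensions)
    (hPT : ∀ t t' δ, 1 ≤ t → t ≤ T_E + T_F → 1 ≤ t' → t' ≤ T_E + T_F →
      1 ≤ δ → δ ≤ t → δ ≤ t' → ∀ (v₁ v₀ : Fin D → ℝ) (x : 𝕏),
        hL t δ v₁ x true - hL t' δ v₁ x true = hL t δ v₀ x false - hL t' δ v₀ x false)
    -- the pivot index `g_{T_E}`
    (g : (Fin D → ℝ) → 𝕏 → Bool → (Fin D → ℝ))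
    (hg : ∀ s ∈ 𝕊, ∀ (x : 𝕏) (a : Bool) (d : Fin D),
      g s x a d = ∫ ω, S T_E ω d ∂(P[|{ω | S 0 ω = s ∧ X ω = x ∧ A ω = a}])) :
    (∫ ω, Y (T_E + T_F) ω ∂(P[|{ω | A ω = true}]))
      - (∫ ω, Y (T_E + T_F) ω ∂(P[|{ω | A ω = false}]))
    = ∫ ω, (hL T_E T_E (g (S 0 ω) (X ω) true) (X ω) true
        - hL T_E T_E (g (S 0 ω) (X ω) false) (X ω) false) ∂P := by
  have hTT : 1 ≤ T_E + T_F := by omega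
  let Z : ℕ → Ω → 𝕊 := fun t ω => ⟨S t ω, hSmem t ω⟩
  have hZ (t : ℕ) : Measurable (Z t) := (hSmeas t).subtype_mk
  let F : Ω → (Fin T_E → 𝕊) × 𝕊 × 𝕏 × Bool :=
    fun ω => (fun i => Z i ω, Z T_E ω, X ω, A ω)
  have hF : Measurable F :=
    (measurable_pi_lambda _ fun i : Fin T_E => hZ i).prodMk ((hZ T_E).prodMk (hX.prodMk hA))
  let G : Ω → 𝕊 × 𝕏 × Bool := fun ω => (Z 0 ω, X ω, A ω)
  have hG : Measurable G := (hZ 0).prodMk (hX.prodMk hA)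
  let φ : (Fin T_E → 𝕊) × 𝕊 × 𝕏 × Bool → ℝ :=
    fun b => hL (T_E + T_F) T_E b.2.1 b.2.2.1 b.2.2.2
  let ψ : 𝕊 × 𝕏 × Bool → ℝ :=
    fun b => hL (T_E + T_F) T_E (g b.1 b.2.1 b.2.2) b.2.1 b.2.2
  have hYint' := hYint (T_E + T_F)
  have hYF := setIntegral_preimage_eq_of_cond P hF hYint' φ (by
    rintro ⟨b, s, x, a⟩ hb
    let hist : ℕ → Fin D → ℝ := fun i => if h : i < T_E then b ⟨i, h⟩ else 0
    have hset : F ⁻¹' {(b, s, x, a)} =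
        {ω | (∀ i < T_E, S i ω = hist i) ∧ S T_E ω = s ∧ X ω = x ∧ A ω = a} := by
      ext ω
      simp only [F, Z, hist, Set.mem_preimage, Set.mem_singleton_iff, Set.mem_ofPred_eq,
        Prod.mk.injEq, funext_iff (α := Fin T_E), Subtype.ext_iff, Fin.forall_iff (n := T_E)]
      refine and_congr_left' (forall₂_congr fun i hi => ?_)
      rw [dif_pos hi]
    rw [hset] at hb ⊢
    have hmap := hsurr (T_E + T_F) (by omega) le_rfl s s.2 x a hist hb
    have hYS : Measurable (fun ω => (Y (T_E + T_F) ω, S (T_E + T_F) ω)) :=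
      (hYmeas _).prodMk (hSmeas _)
    have hint := congrArg (fun ν : Measure (ℝ × (Fin D → ℝ)) => ∫ p, p.1 ∂ν) hmap
    beta_reduce at hint
    rw [integral_map hYS.aemeasurable measurable_fst.aestronglyMeasurable,
      integral_map hYS.aemeasurable measurable_fst.aestronglyMeasurable] at hint
    rw [hint]
    simp only [φ]
    rw [hLagree (T_E + T_F) T_E hTE (by omega) le_rfl s s.2 x a,
      show T_E + T_F - T_E = T_E by omega])
  have hYG := setIntegral_preimage_eq_of_cond P hG hYint' ψ (by
    rintro ⟨s, x, a⟩ hb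
    have hset : G ⁻¹' {(s, x, a)} = {ω | S 0 ω = s ∧ X ω = x ∧ A ω = a} := by
      ext ω
      simp [G, Z, Subtype.ext_iff]
    have hGF : G ⁻¹' {(s, x, a)} =
        F ⁻¹' {b | b.1 ⟨0, hTE⟩ = s ∧ b.2.2.1 = x ∧ b.2.2.2 = a} := by
      ext ω
      simp [G, F]
    have hmeas : MeasurableSet (G ⁻¹' {(s, x, a)}) := hG (measurableSet_singleton _)
    have hcongr : ∫ ω in G ⁻¹' {(s, x, a)}, φ (F ω) ∂P =
        ∫ ω in G ⁻¹' {(s, x, a)}, hL (T_E + T_F) T_E (S T_E ω) x a ∂P := by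
      refine setIntegral_congr_fun hmeas fun ω hω => ?_
      simp only [G, Set.mem_preimage, Set.mem_singleton_iff, Prod.mk.injEq] at hω
      simp only [φ, F, Z, hω.2.1, hω.2.2]
    have hprob : IsProbabilityMeasure (P[|G ⁻¹' {(s, x, a)}]) := cond_isProbabilityMeasure hb
    have hSint (d : Fin D) : Integrable (fun ω => S T_E ω d) (P[|G ⁻¹' {(s, x, a)}]) :=
      integrable_comp_of_finite _ (hZ T_E) fun z => z.1 d
    rw [integral_cond_eq, hGF, hYF, ← hGF, hcongr, ← integral_cond_eq,
      integral_affine _ hSint (hLaffine (T_E + T_F) T_E x a hTE (by omega) le_rfl)]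
    simp only [ψ]
    congr 1
    ext d
    rw [hg s s.2 x a d, hset])
  have hZX : Measurable (fun ω => (Z 0 ω, X ω)) := (hZ 0).prodMk hX
  have hind : IndepFun (fun ω => (Z 0 ω, X ω)) A P := by
    rw [indepFun_iff_measure_inter_preimage_eq_mul] at hindep ⊢
    intro s t _ ht
    have hpre : (fun ω => (Z 0 ω, X ω)) ⁻¹' s =
        (fun ω => (X ω, S 0 ω)) ⁻¹' ((fun z : 𝕊 × 𝕏 => (z.2, (z.1 : Fin D → ℝ))) '' s) := by
      ext ω
      constructor
      · exact fun h => ⟨_, h, rfl⟩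
      · rintro ⟨⟨z, x⟩, hz, he⟩
        simp only [Prod.mk.injEq] at he
        obtain ⟨rfl, he⟩ := he
        have hzω : Z 0 ω = z := Subtype.ext he.symm
        simpa [hzω] using hz
    rw [hpre]
    exact hindep _ _ (Set.toFinite _).measurableSet ht
  have hmean (a : Bool) : ∫ ω, Y (T_E + T_F) ω ∂(P[|{ω | A ω = a}]) =
      ∫ ω, hL (T_E + T_F) T_E (g (S 0 ω) (X ω) a) (X ω) a ∂P := by
    have hset : {ω | A ω = a} = G ⁻¹' {b | b.2.2 = a} := rfl
    have hcongr : ∫ ω in {ω | A ω = a}, ψ (G ω) ∂P =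
        ∫ ω in {ω | A ω = a}, hL (T_E + T_F) T_E (g (S 0 ω) (X ω) a) (X ω) a ∂P := by
      refine setIntegral_congr_fun (hA (measurableSet_singleton a)) fun ω (hω : A ω = a) => ?_
      simp only [ψ, G, Z, hω]
    rw [integral_cond_eq, hset, hYG, ← hset, hcongr, ← integral_cond_eq]
    exact integral_cond_eq_of_indepFun P hZX hA hind a (hApos a)
      fun z => hL (T_E + T_F) T_E (g z.1 z.2 a) z.2 a
  have hint (a : Bool) :
      Integrable (fun ω => hL (T_E + T_F) T_E (g (S 0 ω) (X ω) a) (X ω) a) P :=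
    integrable_comp_of_finite P hZX fun z => hL (T_E + T_F) T_E (g z.1 z.2 a) z.2 a
  rw [hmean, hmean, ← integral_sub (hint true) (hint false)]
  refine integral_congr_ae (ae_of_all _ fun ω => ?_)
  have := hPT (T_E + T_F) T_E T_E hTT le_rfl hTE (by omega) hTE (by omega) le_rfl
    (g (S 0 ω) (X ω) true) (g (S 0 ω) (X ω) false) (X ω)
  simp only
  linarith
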